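/- Consider a mechanical port-Hamiltonian closed-loop system on ℝⁿ × ℝⁿ with state (q,p), storage function S_cl(q,p) = ½⟨p, M(q)⁻¹p⟩ + Vᵗ(q), unforced vector field f_cl(q,p) = (∂S_cl/∂p, −∂S_cl/∂q − D ∂S_cl/∂p), and output y(q,p) = Bᵀ M(q)⁻¹ p. Let M : ℝⁿ → ℝⁿˣⁿ be C¹ with symmetric positive-definite values, let h̄, Vᵗ : ℝⁿ → ℝ be C¹, α_E ∈ ℝ, Ē ∈ ℝ, and set K_e(q,p) = ½⟨p, M(q)⁻¹p⟩ and h(q,p) = −K_e(q,p) + α_E·h̄(q) + Ē. Let α : ℝ → ℝ be continuous, strictly increasing with α(0) = 0. Then for all (q,p): Ψ(q,p) := ⟨∇h(q,p), f_cl(q,p)⟩ + α(h(q,p)) = {α_E·h̄ + Vᵗ, K_e}(q,p) + ⟨M(q)⁻¹p, D M(q)⁻¹p⟩ + α(h(q,p)), where {φ, ξ}(q,p) = ⟨∂φ/∂q, ∂ξ/∂p⟩ − ⟨∂φ/∂p, ∂ξ/∂q⟩ is the Poisson bracket. -/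

import Mathlib

open Matrix

attribute [local instance] Matrix.normedAddCommGroup Matrix.normedSpace

/-- The Euclidean gradient of a scalar function on `ℝⁿ`, as a vector. -/
noncomputable def gradVec {n : ℕ} (φ : (Fin n → ℝ) → ℝ) (z : Fin n → ℝ) :
    Fin n → ℝ :=
  fun i => fderiv ℝ φ z (Pi.single i 1)

/-- Partial gradient `∂φ/∂q` of a function of `(q,p)`. -/
noncomputable def gradq {n : ℕ} (φ : (Fin n → ℝ) → (Fin n → ℝ) → ℝ)
    (q p : Fin n → ℝ) : Fin n → ℝ :=
  gradVec (fun q' => φ q' p) q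

/-- Partial gradient `∂φ/∂p` of a function of `(q,p)`. -/
noncomputable def gradp {n : ℕ} (φ : (Fin n → ℝ) → (Fin n → ℝ) → ℝ)
    (q p : Fin n → ℝ) : Fin n → ℝ :=
  gradVec (φ q) p

/-- Directional derivative `⟨∇φ(q,p), v⟩` of a function of the full state. -/
noncomputable def gradFull {n : ℕ} (φ : (Fin n → ℝ) → (Fin n → ℝ) → ℝ)
    (q p : Fin n → ℝ) (v : (Fin n → ℝ) × (Fin n → ℝ)) : ℝ :=
  fderiv ℝ (fun z : (Fin n → ℝ) × (Fin n → ℝ) => φ z.1 z.2) (q, p) v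

/-- Closed-loop storage function `S_cl(q,p) = ½⟨p, M(q)⁻¹p⟩ + Vᵗ(q)`. -/
noncomputable def Scl {n : ℕ} (M : (Fin n → ℝ) → Matrix (Fin n) (Fin n) ℝ)
    (Vt : (Fin n → ℝ) → ℝ) (q p : Fin n → ℝ) : ℝ :=
  (1 / 2) * (p ⬝ᵥ ((M q)⁻¹ *ᵥ p)) + Vt q

/-- Unforced closed-loop vector field
`f_cl(q,p) = (∂S_cl/∂p, −∂S_cl/∂q − D ∂S_cl/∂p)`. -/
noncomputable def fcl {n : ℕ} (M : (Fin n → ℝ) → Matrix (Fin n) (Fin n) ℝ)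
    (Vt : (Fin n → ℝ) → ℝ) (D : Matrix (Fin n) (Fin n) ℝ) (q p : Fin n → ℝ) :
    (Fin n → ℝ) × (Fin n → ℝ) :=
  (gradp (Scl M Vt) q p,
    -(gradq (Scl M Vt) q p) - D *ᵥ gradp (Scl M Vt) q p)

/-- Poisson bracket on `ℝⁿ × ℝⁿ`:
`{φ, ξ}(q,p) = ⟨∂φ/∂q, ∂ξ/∂p⟩ − ⟨∂φ/∂p, ∂ξ/∂q⟩`. -/
noncomputable def pbracket {n : ℕ} (φ ξ : (Fin n → ℝ) → (Fin n → ℝ) → ℝ)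
    (q p : Fin n → ℝ) : ℝ :=
  gradq φ q p ⬝ᵥ gradp ξ q p - gradp φ q p ⬝ᵥ gradq ξ q p

theorem gradVec_dotProduct {n : ℕ} (φ : (Fin n → ℝ) → ℝ) (z v : Fin n → ℝ) :
    gradVec φ z ⬝ᵥ v = fderiv ℝ φ z v := by
  conv_rhs => rw [pi_eq_sum_univ' v]
  simp [gradVec, dotProduct, map_sum, mul_comm]

theorem gradFull_eq_gradq_add_gradp {n : ℕ} {φ : (Fin n → ℝ) → (Fin n → ℝ) → ℝ}
    {q p : Fin n → ℝ}
    (hφ : DifferentiableAt ℝ (fun z : (Fin n → ℝ) × (Fin n → ℝ) => φ z.1 z.2) (q, p))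
    (v : (Fin n → ℝ) × (Fin n → ℝ)) :
    gradFull φ q p v = gradq φ q p ⬝ᵥ v.1 + gradp φ q p ⬝ᵥ v.2 := by
  have hq := (hφ.hasFDerivAt.comp q (hasFDerivAt_prodMk_left (𝕜 := ℝ) q p)).fderiv
  have hp := (hφ.hasFDerivAt.comp p (hasFDerivAt_prodMk_right (𝕜 := ℝ) q p)).fderiv
  simp only [Function.comp_def] at hq hp
  rw [gradq, gradp, gradVec_dotProduct, gradVec_dotProduct, hq, hp, gradFull]
  simp [← map_add]

theorem differentiable_matrix_det {E : Type*} [NormedAddCommGroup E] [NormedSpace ℝ E] {n : ℕ}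
    {A : E → Matrix (Fin n) (Fin n) ℝ} (hA : ∀ i j, Differentiable ℝ fun x => A x i j) :
    Differentiable ℝ fun x => (A x).det := by
  simp only [det_apply]
  fun_prop

theorem differentiable_matrix_inv_apply {E : Type*} [NormedAddCommGroup E] [NormedSpace ℝ E]
    {n : ℕ} {A : E → Matrix (Fin n) (Fin n) ℝ} (hA : ∀ i j, Differentiable ℝ fun x => A x i j)
    (hdet : ∀ x, (A x).det ≠ 0) (i j : Fin n) :
    Differentiable ℝ fun x => (A x)⁻¹ i j := by
  simp only [inv_def, Matrix.smul_apply, smul_eq_mul, Ring.inverse_eq_inv', adjugate_apply]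
  refine ((differentiable_matrix_det hA).inv hdet).mul (differentiable_matrix_det fun k l => ?_)
  rcases eq_or_ne k j with rfl | hk
  · simp [updateRow_self]
  · simpa [updateRow_ne hk] using hA k l

theorem gradVec_quadratic {n : ℕ} {A : Matrix (Fin n) (Fin n) ℝ} (hA : A.IsSymm)
    (p : Fin n → ℝ) :
    gradVec (fun x => (1 / 2) * (x ⬝ᵥ (A *ᵥ x))) p = A *ᵥ p := by
  have hL : HasFDerivAt (fun x : Fin n → ℝ => A *ᵥ x)
      (LinearMap.toContinuousLinearMap A.mulVecLin) p :=
    (LinearMap.toContinuousLinearMap A.mulVecLin).hasFDerivAt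
  have hi (i : Fin n) := hasFDerivAt_pi'.1 hL i
  have hsum := HasFDerivAt.fun_sum (u := Finset.univ) fun i _ =>
    (hasFDerivAt_apply (𝕜 := ℝ) i p).mul (hi i)
  have hquad : HasFDerivAt (fun x : Fin n → ℝ => (1 / 2) * (x ⬝ᵥ (A *ᵥ x))) _ p :=
    hsum.const_mul (1 / 2 : ℝ)
  ext j
  have hcol : ∑ i, p i * A i j = (A *ᵥ p) j := by
    simp only [mulVec, dotProduct]
    exact Finset.sum_congr rfl fun i _ => by rw [mul_comm, hA.apply]
  rw [gradVec, hquad.fderiv]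
  simp [Finset.sum_add_distrib, Pi.single_apply, hcol]
  ring

/-- **Corollary 1 (second part).** For the generalised energy-based CBF
`h = −K_e + α_E h̄ + Ē` on a mechanical port-Hamiltonian closed loop, the CBF
constraint value decomposes as
`Ψ = {α_E h̄ + Vᵗ, K_e} + ⟨M⁻¹p, D M⁻¹p⟩ + α(h)`. -/
theorem constraint_decomposition_energy_CBF
    (n : ℕ) (M : (Fin n → ℝ) → Matrix (Fin n) (Fin n) ℝ)
    (hM : ContDiff ℝ 1 M) (hMpd : ∀ q, (M q).PosDef)
    (hbar Vt : (Fin n → ℝ) → ℝ)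
    (hhbar : ContDiff ℝ 1 hbar) (hVt : ContDiff ℝ 1 Vt)
    (D B : Matrix (Fin n) (Fin n) ℝ) (hD : D.PosSemidef) (hB : IsUnit B.det)
    (αE Ebar : ℝ)
    (α : ℝ → ℝ) (hαc : Continuous α) (hαm : StrictMono α) (hα0 : α 0 = 0)
    (Ke : (Fin n → ℝ) → (Fin n → ℝ) → ℝ)
    (hKe : Ke = fun q p => (1 / 2) * (p ⬝ᵥ ((M q)⁻¹ *ᵥ p)))
    (h : (Fin n → ℝ) → (Fin n → ℝ) → ℝ)
    (hdef : h = fun q p => -(Ke q p) + αE * hbar q + Ebar)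
    (Ψ : (Fin n → ℝ) → (Fin n → ℝ) → ℝ)
    (hΨ : ∀ q p, Ψ q p = gradFull h q p (fcl M Vt D q p) + α (h q p)) :
    ∀ q p : Fin n → ℝ,
      Ψ q p = pbracket (fun q' _ => αE * hbar q' + Vt q') Ke q p
        + ((M q)⁻¹ *ᵥ p) ⬝ᵥ (D *ᵥ ((M q)⁻¹ *ᵥ p))
        + α (h q p) := by
  intro q p
  have hdet (q) : (M q).det ≠ 0 := (hMpd q).det_pos.ne'
  have hMd (i j) : Differentiable ℝ fun q => M q i j := fun q =>
    differentiableAt_pi.1 (differentiableAt_pi.1 (hM.differentiable one_ne_zero q) i) j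
  have hinv (i j) := differentiable_matrix_inv_apply hMd hdet i j
  have hK : Differentiable ℝ fun z : (Fin n → ℝ) × (Fin n → ℝ) => Ke z.1 z.2 := by
    have hinv' (i j) : Differentiable ℝ fun z : (Fin n → ℝ) × (Fin n → ℝ) => (M z.1)⁻¹ i j :=
      (hinv i j).comp differentiable_fst
    have hp (i) : Differentiable ℝ fun z : (Fin n → ℝ) × (Fin n → ℝ) => z.2 i := by fun_prop
    simp only [hKe, dotProduct, mulVec]
    exact (Differentiable.fun_sum fun i _ => (hp i).mul
      (Differentiable.fun_sum fun j _ => (hinv' i j).mul (hp j))).const_mul _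
  have hhd : Differentiable ℝ hbar := hhbar.differentiable one_ne_zero
  have hVd : Differentiable ℝ Vt := hVt.differentiable one_ne_zero
  have hKq : Differentiable ℝ fun q' => Ke q' p :=
    hK.comp (differentiable_id.prodMk (differentiable_const p))
  have hh : Differentiable ℝ fun z : (Fin n → ℝ) × (Fin n → ℝ) => h z.1 z.2 := by
    have hb : Differentiable ℝ fun z : (Fin n → ℝ) × (Fin n → ℝ) => hbar z.1 :=
      hhd.comp differentiable_fst
    simp only [hdef]
    fun_prop
  have hScl : Scl M Vt = fun q p => Ke q p + Vt q := by
    rw [hKe]; rfl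
  have hKp : gradp Ke q p = (M q)⁻¹ *ᵥ p := by
    have hs : (M q)⁻¹.IsSymm := (hMpd q).inv.isHermitian
    rw [hKe]
    exact gradVec_quadratic hs p
  have hSp : gradp (Scl M Vt) q p = gradp Ke q p := by
    ext i
    simp [gradp, gradVec, hScl]
  have hSq : gradq (Scl M Vt) q p = gradq Ke q p + gradVec Vt q := by
    ext i
    simp [gradq, gradVec, hScl, fderiv_fun_add (hKq q) (hVd q)]
  have hhp : gradp h q p = -gradp Ke q p := by
    ext i
    simp [gradp, gradVec, hdef, fderiv_fun_neg]
  have hhq : gradq h q p = -gradq Ke q p + αE • gradVec hbar q := by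
    ext i
    simp [gradq, gradVec, hdef, fderiv_fun_add (hKq q).fun_neg ((hhd q).const_mul αE),
      fderiv_fun_neg, fderiv_const_mul (hhd q)]
  have hφq : gradq (fun q' _ => αE * hbar q' + Vt q') q p
      = αE • gradVec hbar q + gradVec Vt q := by
    ext i
    simp [gradq, gradVec, fderiv_fun_add ((hhd q).const_mul αE) (hVd q),
      fderiv_const_mul (hhd q)]
  have hφp : gradp (fun q' _ => αE * hbar q' + Vt q') q p = 0 := by
    ext i
    simp [gradp, gradVec]
  rw [hΨ, gradFull_eq_gradq_add_gradp (hh _), pbracket, fcl, hSp, hSq, hhp, hhq, hφq, hφp, ← hKp]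
  simp only [dotProduct_sub, dotProduct_neg, dotProduct_add, add_dotProduct, neg_dotProduct,
    zero_dotProduct, dotProduct_comm (gradp Ke q p) (gradq Ke q p),
    dotProduct_comm (gradp Ke q p) (gradVec Vt q)]
  ring
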